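/- The Haezendonck–Goovaerts premium principle π_α is Lipschitz continuous on L^Φ with respect to the Luxemburg norm: for all X,Y ∈ L^Φ, |π_α(X) − π_α(Y)| ≤ ‖X−Y‖_Φ / (1−α). -/

import Mathlib

open MeasureTheory Filter Set Topology

/-- The Luxemburg norm associated with the Orlicz function `Θ`. -/
noncomputable def luxNorm {Ω : Type*} [MeasurableSpace Ω] (μ : Measure Ω)
    (Θ : ℝ → ℝ) (X : Ω → ℝ) : ℝ :=
  sInf {l : ℝ | 0 < l ∧ ∫⁻ ω, ENNReal.ofReal (Θ (|X ω| / l)) ∂μ ≤ 1}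

/-- Membership in the Orlicz space `L^Θ`. -/
def MemOrlicz {Ω : Type*} [MeasurableSpace Ω] (μ : Measure Ω)
    (Θ : ℝ → ℝ) (X : Ω → ℝ) : Prop :=
  Measurable X ∧ ∃ l : ℝ, 0 < l ∧ ∫⁻ ω, ENNReal.ofReal (Θ (|X ω| / l)) ∂μ < ⊤

/-- The Haezendonck–Goovaerts premium principle at level `α`. -/
noncomputable def piHG {Ω : Type*} [MeasurableSpace Ω] (μ : Measure Ω)
    (Φ : ℝ → ℝ) (α : ℝ) (X : Ω → ℝ) : ℝ :=
  ⨅ m : ℝ, (m + luxNorm μ (fun x => Φ x / (1 - α)) (fun ω => max (X ω - m) 0))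

def luxSet {Ω : Type*} [MeasurableSpace Ω] (μ : Measure Ω)
    (Θ : ℝ → ℝ) (X : Ω → ℝ) : Set ℝ :=
  {l : ℝ | 0 < l ∧ ∫⁻ ω, ENNReal.ofReal (Θ (|X ω| / l)) ∂μ ≤ 1}

lemma luxSet_bdd {Ω : Type*} [MeasurableSpace Ω] (μ : Measure Ω)
    (Θ : ℝ → ℝ) (X : Ω → ℝ) : BddBelow (luxSet μ Θ X) := ⟨0, fun _ h => h.1.le⟩

lemma luxNorm_nn {Ω : Type*} [MeasurableSpace Ω] (μ : Measure Ω)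
    (Θ : ℝ → ℝ) (X : Ω → ℝ) : 0 ≤ luxNorm μ Θ X :=
  Real.sInf_nonneg (fun _ h => h.1.le)

/-- scaling by convexity -/
lemma conv_scale {Θ : ℝ → ℝ} (h0 : Θ 0 = 0) (hc : ConvexOn ℝ (Ici 0) Θ) {t x : ℝ}
    (ht0 : 0 ≤ t) (ht1 : t ≤ 1) (hx : 0 ≤ x) : Θ (t * x) ≤ t * Θ x := by
  have := hc.2 (mem_Ici.2 hx) (mem_Ici.2 le_rfl) ht0 (sub_nonneg.2 ht1) (by ring)
  simpa [h0] using this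

lemma luxSet_add {Ω : Type*} [MeasurableSpace Ω] (μ : Measure Ω)
    {Θ : ℝ → ℝ} (h0 : Θ 0 = 0) (hm : MonotoneOn Θ (Ici 0)) (hc : ConvexOn ℝ (Ici 0) Θ)
    {U V Z : Ω → ℝ} (hU : Measurable U) (hZ : ∀ ω, |Z ω| ≤ |U ω| + |V ω|) {a b : ℝ}
    (ha : a ∈ luxSet μ Θ U) (hb : b ∈ luxSet μ Θ V) : a + b ∈ luxSet μ Θ Z := by
  obtain ⟨ha0, ha⟩ := ha
  obtain ⟨hb0, hb⟩ := hb
  have hab : 0 < a + b := by positivity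
  refine ⟨hab, ?_⟩
  have hnn : ∀ x, 0 ≤ x → 0 ≤ Θ x := fun x hx => by
    have := hm (mem_Ici.2 le_rfl) (mem_Ici.2 hx) hx
    rwa [h0] at this
  have hmeas : Measurable (fun ω => ENNReal.ofReal (Θ (|U ω| / a))) := by
    have hg : Monotone (fun x => Θ (max x 0)) := fun x y hxy =>
      hm (mem_Ici.2 (le_max_right _ _)) (mem_Ici.2 (le_max_right _ _)) (max_le_max_right _ hxy)
    have h2 : Measurable (fun ω => |U ω| / a) := (measurable_norm.comp hU).div_const a
    have h1 := (hg.measurable.comp h2).ennreal_ofReal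
    convert h1 using 3 with ω
    have : 0 ≤ |U ω| / a := by positivity
    simp [max_eq_left this]
  have hpt : ∀ ω, ENNReal.ofReal (Θ (|Z ω| / (a + b))) ≤
      ENNReal.ofReal (a / (a + b)) * ENNReal.ofReal (Θ (|U ω| / a)) +
      ENNReal.ofReal (b / (a + b)) * ENNReal.ofReal (Θ (|V ω| / b)) := by
    intro ω
    have hu : 0 ≤ |U ω| / a := by positivity
    have hv : 0 ≤ |V ω| / b := by positivity
    rw [← ENNReal.ofReal_mul (by positivity), ← ENNReal.ofReal_mul (by positivity),
      ← ENNReal.ofReal_add (mul_nonneg (by positivity) (hnn _ hu))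
        (mul_nonneg (by positivity) (hnn _ hv))]
    apply ENNReal.ofReal_le_ofReal
    have h1 := hc.2 (mem_Ici.2 hu) (mem_Ici.2 hv) (by positivity : 0 ≤ a / (a + b))
      (by positivity : 0 ≤ b / (a + b)) (by field_simp)
    simp only [smul_eq_mul] at h1
    refine le_trans ?_ h1
    have e : a / (a + b) * (|U ω| / a) + b / (a + b) * (|V ω| / b)
        = (|U ω| + |V ω|) / (a + b) := by field_simp
    rw [e]
    exact hm (mem_Ici.2 (by positivity)) (mem_Ici.2 (by positivity))
      (by gcongr; exact hZ ω)
  refine (lintegral_mono hpt).trans ?_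
  rw [lintegral_add_left (hmeas.const_mul _), lintegral_const_mul' _ _ ENNReal.ofReal_ne_top,
    lintegral_const_mul' _ _ ENNReal.ofReal_ne_top]
  calc _ ≤ ENNReal.ofReal (a / (a + b)) * 1 + ENNReal.ofReal (b / (a + b)) * 1 := by gcongr
    _ = 1 := by
      rw [mul_one, mul_one, ← ENNReal.ofReal_add (by positivity) (by positivity)]
      rw [show a / (a + b) + b / (a + b) = 1 by field_simp, ENNReal.ofReal_one]

lemma luxNorm_add {Ω : Type*} [MeasurableSpace Ω] (μ : Measure Ω)
    {Θ : ℝ → ℝ} (h0 : Θ 0 = 0) (hm : MonotoneOn Θ (Ici 0)) (hc : ConvexOn ℝ (Ici 0) Θ)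
    {U V Z : Ω → ℝ} (hU : Measurable U) (hZ : ∀ ω, |Z ω| ≤ |U ω| + |V ω|)
    (nU : (luxSet μ Θ U).Nonempty) (nV : (luxSet μ Θ V).Nonempty) :
    luxNorm μ Θ Z ≤ luxNorm μ Θ U + luxNorm μ Θ V := by
  have h1 : ∀ a ∈ luxSet μ Θ U, luxNorm μ Θ Z - a ≤ luxNorm μ Θ V := fun a ha =>
    le_csInf nV (fun b hb => by
      have := csInf_le (luxSet_bdd μ Θ Z) (luxSet_add μ h0 hm hc hU hZ ha hb)
      change luxNorm μ Θ Z ≤ a + b at this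
      linarith)
  have h2 : luxNorm μ Θ Z - luxNorm μ Θ V ≤ luxNorm μ Θ U :=
    le_csInf nU (fun a ha => by linarith [h1 a ha])
  linarith

lemma luxSet_nonempty {Ω : Type*} [MeasurableSpace Ω] (μ : Measure Ω)
    {Θ : ℝ → ℝ} (h0 : Θ 0 = 0) (hc : ConvexOn ℝ (Ici 0) Θ)
    {X : Ω → ℝ} (hX : MemOrlicz μ Θ X) : (luxSet μ Θ X).Nonempty := by
  obtain ⟨_, l, hl, hI⟩ := hX
  set I := ∫⁻ ω, ENNReal.ofReal (Θ (|X ω| / l)) ∂μ with hIdef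
  have hs : 0 < I.toReal + 1 := by positivity
  refine ⟨l * (I.toReal + 1), by positivity, ?_⟩
  have hpt : ∀ ω, ENNReal.ofReal (Θ (|X ω| / (l * (I.toReal + 1)))) ≤
      ENNReal.ofReal (1 / (I.toReal + 1)) * ENNReal.ofReal (Θ (|X ω| / l)) := fun ω => by
    rw [← ENNReal.ofReal_mul (by positivity)]
    apply ENNReal.ofReal_le_ofReal
    have := conv_scale h0 hc (t := 1 / (I.toReal + 1)) (x := |X ω| / l) (by positivity)
      (by rw [div_le_one hs]; linarith [ENNReal.toReal_nonneg (a := I)]) (by positivity)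
    convert this using 2
    field_simp
  refine (lintegral_mono hpt).trans ?_
  rw [lintegral_const_mul' _ _ ENNReal.ofReal_ne_top, ← hIdef]
  nth_rewrite 2 [← ENNReal.ofReal_toReal hI.ne]
  rw [← ENNReal.ofReal_mul (by positivity), ← ENNReal.ofReal_one]
  apply ENNReal.ofReal_le_ofReal
  rw [one_div_mul_eq_div, div_le_one hs]
  linarith

lemma luxSet_div {Ω : Type*} [MeasurableSpace Ω] (μ : Measure Ω)
    {Θ : ℝ → ℝ} (h0 : Θ 0 = 0) (hc : ConvexOn ℝ (Ici 0) Θ) {c : ℝ} (c0 : 0 < c) (c1 : c ≤ 1)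
    {X : Ω → ℝ} {l : ℝ} (hl : l ∈ luxSet μ Θ X) : l / c ∈ luxSet μ (fun x => Θ x / c) X := by
  obtain ⟨l0, hl⟩ := hl
  refine ⟨by positivity, le_trans (lintegral_mono fun ω => ?_) hl⟩
  apply ENNReal.ofReal_le_ofReal
  have := conv_scale h0 hc c0.le c1 (x := |X ω| / l) (by positivity)
  rw [show c * (|X ω| / l) = |X ω| / (l / c) by field_simp] at this
  change Θ (|X ω| / (l / c)) / c ≤ Θ (|X ω| / l)
  rw [div_le_iff₀ c0, mul_comm _ c]
  exact this

lemma piHG_le {Ω : Type*} [MeasurableSpace Ω] (μ : Measure Ω) [IsProbabilityMeasure μ]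
    (Φ : ℝ → ℝ) (hΦ0 : Φ 0 = 0) (hΦ1 : Φ 1 = 1)
    (hΦmono : MonotoneOn Φ (Ici 0)) (hΦconv : ConvexOn ℝ (Ici 0) Φ)
    (α : ℝ) (hα : α ∈ Ioo (0 : ℝ) 1)
    (X Y : Ω → ℝ) (hX : MemOrlicz μ Φ X) (hY : MemOrlicz μ Φ Y) :
    piHG μ Φ α X - piHG μ Φ α Y ≤ luxNorm μ Φ (fun ω => X ω - Y ω) / (1 - α) := by
  have c0 : 0 < 1 - α := by linarith [hα.2]
  have c1 : 1 - α ≤ 1 := by linarith [hα.1]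
  set c := 1 - α with hcdef
  set Θ : ℝ → ℝ := fun x => Φ x / c with hΘ
  have t0 : Θ 0 = 0 := by simp [hΘ, hΦ0]
  have tm : MonotoneOn Θ (Ici 0) := fun x hx y hy hxy =>
    div_le_div_of_nonneg_right (hΦmono hx hy hxy) c0.le
  have tc : ConvexOn ℝ (Ici 0) Θ := by
    have := hΦconv.smul (inv_nonneg.2 c0.le)
    have e : Θ = fun x => c⁻¹ • Φ x := by
      funext x
      simp only [hΘ, smul_eq_mul, div_eq_inv_mul]
    rw [e]
    exact this
  have nX := luxSet_nonempty μ hΦ0 hΦconv hX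
  have nY := luxSet_nonempty μ hΦ0 hΦconv hY
  have nconst : ∀ k : ℝ, (luxSet μ Φ (fun _ => k)).Nonempty := fun k =>
    luxSet_nonempty μ hΦ0 hΦconv ⟨measurable_const, 1, one_pos, by simp⟩
  have up : ∀ Z : Ω → ℝ, (luxSet μ Φ Z).Nonempty → (luxSet μ Θ Z).Nonempty :=
    fun Z ⟨l, hl⟩ => ⟨_, luxSet_div μ hΦ0 hΦconv c0 c1 hl⟩
  have npos : ∀ Z : Ω → ℝ, Measurable Z → (luxSet μ Φ Z).Nonempty → ∀ m : ℝ,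
      (luxSet μ Θ (fun ω => max (Z ω - m) 0)).Nonempty := fun Z hZ ⟨a, ha⟩ m => by
    obtain ⟨b, hb⟩ := nconst m
    refine up _ ⟨a + b, luxSet_add μ hΦ0 hΦmono hΦconv hZ (fun ω => ?_) ha hb⟩
    rw [abs_of_nonneg (le_max_right _ _)]
    exact max_le ((le_abs_self _).trans (abs_sub _ _)) (by positivity)
  have nD : (luxSet μ Φ (fun ω => X ω - Y ω)).Nonempty := by
    obtain ⟨a, ha⟩ := nX
    obtain ⟨b, hb⟩ := nY
    exact ⟨a + b, luxSet_add μ hΦ0 hΦmono hΦconv hX.1 (fun ω => abs_sub _ _) ha hb⟩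
  have hD : luxNorm μ Θ (fun ω => X ω - Y ω) ≤ luxNorm μ Φ (fun ω => X ω - Y ω) / c := by
    rw [le_div_iff₀ c0]
    refine le_csInf nD (fun l hl => ?_)
    rw [← le_div_iff₀ c0]
    exact csInf_le (luxSet_bdd μ Θ _) (luxSet_div μ hΦ0 hΦconv c0 c1 hl)
  have hmeas : ∀ Z : Ω → ℝ, Measurable Z → ∀ m : ℝ, Measurable (fun ω => max (Z ω - m) 0) :=
    fun Z hZ m => (hZ.sub_const m).max measurable_const
  have hconst : ∀ k : ℝ, 0 < k → k ≤ luxNorm μ Θ (fun _ : Ω => k) := fun k hk => by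
    refine le_csInf (up _ (nconst k)) (fun l hl => ?_)
    obtain ⟨l0, hl⟩ := hl
    by_contra! hlt
    simp only [lintegral_const, measure_univ, mul_one, abs_of_pos hk] at hl
    rw [ENNReal.ofReal_le_one] at hl
    have h1 : (1 : ℝ) ≤ k / l := by rw [le_div_iff₀ l0]; linarith
    have h2 := hΦmono (mem_Ici.2 zero_le_one) (mem_Ici.2 (by positivity)) h1
    rw [hΦ1] at h2
    have h3 : Φ (k / l) ≤ c := by
      have h4 : Φ (k / l) / c ≤ 1 := hl
      rwa [div_le_one c0] at h4
    linarith [hα.1]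
  have hbdd : BddBelow (range fun m : ℝ => m + luxNorm μ Θ (fun ω => max (X ω - m) 0)) := by
    refine ⟨-luxNorm μ Θ X, ?_⟩
    rintro _ ⟨m, rfl⟩
    simp only
    have p1 := luxNorm_nn μ Θ X
    have p2 := luxNorm_nn μ Θ (fun ω => max (X ω - m) 0)
    rcases le_or_gt 0 m with h | h
    · linarith
    · have q := luxNorm_add μ t0 tm tc (Z := fun _ => -m) hX.1 (fun ω => ?_) (up _ nX)
        (npos X hX.1 nX m)
      · linarith [hconst (-m) (by linarith)]
      · rw [abs_of_pos (by linarith : 0 < -m), abs_of_nonneg (le_max_right (X ω - m) 0)]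
        linarith [neg_abs_le (X ω), le_abs_self (X ω), le_max_left (X ω - m) 0,
          neg_le_abs (X ω), abs_nonneg (X ω)]
  rw [sub_le_comm]
  refine le_ciInf fun m => ?_
  have r1 : piHG μ Φ α X ≤ m + luxNorm μ Θ (fun ω => max (X ω - m) 0) := ciInf_le hbdd m
  have r2 := luxNorm_add μ t0 tm tc (Z := fun ω => max (X ω - m) 0) (hmeas Y hY.1 m)
    (fun ω => ?_) (npos Y hY.1 nY m) (up _ nD)
  · change _ ≤ m + luxNorm μ Θ (fun ω => max (Y ω - m) 0)
    linarith
  · rw [abs_of_nonneg (le_max_right _ _), abs_of_nonneg (le_max_right _ _)]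
    refine max_le ?_ (by positivity)
    linarith [le_abs_self (X ω - Y ω), le_max_left (Y ω - m) 0]

/-- The Haezendonck–Goovaerts premium principle is Lipschitz with respect to the Luxemburg
norm: `|π_α(X) - π_α(Y)| ≤ ‖X - Y‖_Φ / (1 - α)` for all `X, Y ∈ L^Φ`. -/
theorem stmt_3 {Ω : Type*} [MeasurableSpace Ω] (μ : Measure Ω) [IsProbabilityMeasure μ]
    (hNA : ∀ A : Set Ω, MeasurableSet A → 0 < μ A →
      ∃ B : Set Ω, B ⊆ A ∧ MeasurableSet B ∧ 0 < μ B ∧ μ B < μ A)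
    (Φ : ℝ → ℝ) (hΦ0 : Φ 0 = 0) (hΦ1 : Φ 1 = 1)
    (hΦmono : MonotoneOn Φ (Ici 0)) (hΦconv : ConvexOn ℝ (Ici 0) Φ)
    (α : ℝ) (hα : α ∈ Ioo (0 : ℝ) 1)
    (X Y : Ω → ℝ) (hX : MemOrlicz μ Φ X) (hY : MemOrlicz μ Φ Y) :
    |piHG μ Φ α X - piHG μ Φ α Y| ≤ luxNorm μ Φ (fun ω => X ω - Y ω) / (1 - α) := by
  rw [abs_le']
  refine ⟨piHG_le μ Φ hΦ0 hΦ1 hΦmono hΦconv α hα X Y hX hY, ?_⟩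
  have h := piHG_le μ Φ hΦ0 hΦ1 hΦmono hΦconv α hα Y X hY hX
  have e : luxNorm μ Φ (fun ω => Y ω - X ω) = luxNorm μ Φ (fun ω => X ω - Y ω) := by
    simp only [luxNorm, abs_sub_comm]
  rw [e] at h
  linarith
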